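/- Let 1<p≤2 and let U⊂(0,∞) be nonempty. If p<p_cr(U), then the maximal operator 𝓜^U is not bounded on L^p(ℝ²): there is no finite constant C with ‖𝓜^U f‖_{L^p(ℝ²)} ≤ C‖f‖_{L^p(ℝ²)} for all Schwartz functions f on ℝ². -/

import Mathlib

open MeasureTheory Filter Set Topology
open scoped ENNReal NNReal Topology Classical

noncomputable section

/-- The homogeneous curve of degree `b`: `γ_b(t) = c₊ t^b` for `t > 0`,
`γ_b(t) = c₋ (-t)^b` for `t < 0`, `γ_b(0) = 0`. -/
def curve (b cp cm t : ℝ) : ℝ :=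
  if 0 < t then cp * t ^ b else if t < 0 then cm * (-t) ^ b else 0

/-- The maximal function along the curve `(t, u γ_b(t))`. -/
def Mu (b cp cm u : ℝ) (f : ℝ × ℝ → ℝ) (x : ℝ × ℝ) : ℝ :=
  ⨆ R : {R : ℝ // 0 < R},
    ((R : ℝ))⁻¹ * ∫ t in (0:ℝ)..(R : ℝ), |f (x - (t, u * curve b cp cm t))|

/-- The maximal function `𝓜^U f = sup_{u ∈ U} M^{(u)} f`. -/
def calM (b cp cm : ℝ) (U : Set ℝ) (f : ℝ × ℝ → ℝ) (x : ℝ × ℝ) : ℝ :=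
  ⨆ u : U, Mu b cp cm (u : ℝ) f x

/-- The Hilbert transform along the curve `(t, u γ_b(t))` (principal value). -/
def Hu (b cp cm u : ℝ) (f : ℝ × ℝ → ℝ) (x : ℝ × ℝ) : ℝ :=
  limUnder (𝓝[>] (0:ℝ)) fun ε : ℝ =>
    ∫ t in {t : ℝ | ε < |t| ∧ |t| < ε⁻¹}, f (x - (t, u * curve b cp cm t)) / t

/-- The maximal function `𝓗^U f = sup_{u ∈ U} |H^{(u)} f|`, valued in `ℝ≥0∞`. -/
def calH (b cp cm : ℝ) (U : Set ℝ) (f : ℝ × ℝ → ℝ) (x : ℝ × ℝ) : ℝ≥0∞ :=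
  ⨆ u : U, ENNReal.ofReal |Hu b cp cm (u : ℝ) f x|

/-- The `L^p` norm of an `ℝ≥0∞`-valued function on `ℝ²`. -/
def lpN (g : ℝ × ℝ → ℝ≥0∞) (p : ℝ) : ℝ≥0∞ :=
  (∫⁻ x : ℝ × ℝ, g x ^ p) ^ (1 / p)

def eN (p : ℝ) : ℝ≥0∞ := ENNReal.ofReal p

/-- `U^r = r⁻¹ U ∩ [1,2] = {ρ ∈ [1,2] : rρ ∈ U}`. -/
def UrSet (U : Set ℝ) (r : ℝ) : Set ℝ := {ρ : ℝ | ρ ∈ Icc (1:ℝ) 2 ∧ r * ρ ∈ U}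

/-- `N(A,δ)`: minimal number of intervals of length `δ` needed to cover `A`. -/
def covN (A : Set ℝ) (δ : ℝ) : ℕ :=
  sInf {n : ℕ | ∃ F : Finset ℝ, F.card = n ∧ A ⊆ ⋃ a ∈ F, Icc a (a + δ)}

/-- `𝒦_p(U,δ) = δ^{1-1/p} sup_{r>0} N(U^r,δ)^{1/p}`. -/
def Kp (U : Set ℝ) (δ p : ℝ) : ℝ :=
  δ ^ (1 - 1 / p) * ⨆ r : {r : ℝ // 0 < r}, ((covN (UrSet U (r : ℝ)) δ : ℝ)) ^ (1 / p)

/-- `p_cr(U) = 1 + limsup_{δ→0+} sup_{r>0} log N(U^r,δ) / log(1/δ)`. -/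
def pcr (U : Set ℝ) : ℝ :=
  1 + limsup (fun δ : ℝ =>
      (⨆ r : {r : ℝ // 0 < r}, Real.log (covN (UrSet U (r : ℝ)) δ)) / Real.log δ⁻¹)
    (𝓝[>] (0:ℝ))

/-- `𝔑(U) = 1 + #{n ∈ ℤ : [2ⁿ, 2ⁿ⁺¹] ∩ U ≠ ∅}`. -/
def frakN (U : Set ℝ) : ℕ∞ :=
  1 + Set.encard {n : ℤ | (Icc ((2:ℝ) ^ n) ((2:ℝ) ^ (n + 1)) ∩ U).Nonempty}

/-- `√(log 𝔑(U))`, valued in `ℝ≥0∞` (equal to `∞` if `𝔑(U) = ∞`). -/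
def sqrtLogN (U : Set ℝ) : ℝ≥0∞ :=
  if frakN U = ⊤ then ⊤
  else ENNReal.ofReal (Real.sqrt (Real.log ((frakN U).toNat : ℝ)))

/-- The `L^p → L^p` operator norm of `𝓜^U` (smallest admissible constant, possibly `∞`). -/
def opNormM (b cp cm : ℝ) (U : Set ℝ) (p : ℝ) : ℝ≥0∞ :=
  sInf {C : ℝ≥0∞ | ∀ f : SchwartzMap (ℝ × ℝ) ℝ,
    eLpNorm (calM b cp cm U ⇑f) (eN p) volume ≤ C * eLpNorm ⇑f (eN p) volume}

/-- The `L^p → L^p` operator norm of `𝓗^U` (smallest admissible constant, possibly `∞`). -/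
def opNormH (b cp cm : ℝ) (U : Set ℝ) (p : ℝ) : ℝ≥0∞ :=
  sInf {C : ℝ≥0∞ | ∀ f : SchwartzMap (ℝ × ℝ) ℝ,
    lpN (calH b cp cm U ⇑f) p ≤ C * eLpNorm ⇑f (eN p) volume}

/-- `θ_{p,ℓ}`. -/
def theta (p : ℝ) (l : ℕ) : ℝ :=
  if (l : ℝ) ≤ (p - 1)⁻¹ then (p - 1) ^ (3 - 10 / p) else (l : ℝ) ^ (7 * (2 / p - 1))

/-- `Σ_{ℓ≥1} θ_{p,ℓ} 𝒦_p(U, 2^{-ℓ})`, valued in `ℝ≥0∞`. -/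
def KpSum (U : Set ℝ) (p : ℝ) : ℝ≥0∞ :=
  ∑' l : ℕ, ENNReal.ofReal (theta p (l + 1) * Kp U ((2:ℝ) ^ (-((l : ℝ) + 1))) p)

/-- A set in `[1,2]` meets at least `covN A δ` cells of the grid of mesh `δ`. -/
lemma exists_grid_cells (A : Set ℝ) (hA : A ⊆ Icc 1 2) (δ : ℝ) (hδ : 0 < δ) :
    ∃ K : Finset ℤ, covN A δ ≤ K.card ∧
      ∀ k ∈ K, ∃ ρ ∈ A, (k : ℝ) * δ ≤ ρ ∧ ρ ≤ (k : ℝ) * δ + δ := by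
  classical
  set K : Finset ℤ := (Finset.Icc ⌊1 / δ⌋ ⌊2 / δ⌋).filter
    (fun k => ∃ ρ ∈ A, (k : ℝ) * δ ≤ ρ ∧ ρ ≤ (k : ℝ) * δ + δ) with hK
  refine ⟨K, ?_, fun k hk => (Finset.mem_filter.1 hk).2⟩
  have hcov : A ⊆ ⋃ a ∈ K.image (fun k : ℤ => (k : ℝ) * δ), Icc a (a + δ) := by
    intro ρ hρ
    have h1 : (⌊ρ / δ⌋ : ℝ) * δ ≤ ρ := (le_div_iff₀ hδ).1 (Int.floor_le _)
    have h2 : ρ ≤ (⌊ρ / δ⌋ : ℝ) * δ + δ := by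
      have := (div_lt_iff₀ hδ).1 (Int.lt_floor_add_one (ρ / δ))
      linarith
    have hmem : ⌊ρ / δ⌋ ∈ K := by
      refine Finset.mem_filter.2 ⟨Finset.mem_Icc.2 ⟨Int.floor_le_floor ?_, Int.floor_le_floor ?_⟩,
        ρ, hρ, h1, h2⟩
      · exact div_le_div_of_nonneg_right (hA hρ).1 hδ.le
      · exact div_le_div_of_nonneg_right (hA hρ).2 hδ.le
    exact mem_biUnion (Finset.mem_coe.2 (Finset.mem_image_of_mem _ hmem)) ⟨h1, h2⟩
  have hle : covN A δ ≤ (K.image fun k : ℤ => (k : ℝ) * δ).card :=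
    Nat.sInf_le ⟨K.image fun k : ℤ => (k : ℝ) * δ, rfl, hcov⟩
  exact hle.trans Finset.card_image_le

/-- The union of the cells of the grid of mesh `δ` indexed by `K`. -/
def gridUnion (K : Finset ℤ) (δ : ℝ) : Set ℝ :=
  ⋃ k ∈ K, Ico ((k : ℝ) * δ) ((k : ℝ) * δ + δ)

lemma measurableSet_gridUnion (K : Finset ℤ) (δ : ℝ) : MeasurableSet (gridUnion K δ) :=
  Finset.measurableSet_biUnion _ fun _ _ => measurableSet_Ico

lemma volume_gridUnion (K : Finset ℤ) (δ : ℝ) (hδ : 0 < δ) :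
    volume (gridUnion K δ) = ENNReal.ofReal (K.card * δ) := by
  have hfl : ∀ k : ℤ, ∀ s ∈ Ico ((k : ℝ) * δ) ((k : ℝ) * δ + δ), ⌊s / δ⌋ = k := by
    intro k s hs
    rw [Int.floor_eq_iff, le_div_iff₀ hδ, div_lt_iff₀ hδ]
    exact ⟨hs.1, by linarith [hs.2]⟩
  rw [gridUnion, measure_biUnion_finset _ fun _ _ => measurableSet_Ico]
  · simp [Real.volume_Ico, ENNReal.ofReal_mul]
  · intro j _ k _ hjk
    refine Set.disjoint_left.2 fun s hj hk => hjk ?_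
    rw [← hfl j s hj, hfl k s hk]

/-- The points of the strip `1 ≤ x₁ ≤ 2` on the curves `x₂ = κ σ x₁ ^ b`, `σ ∈ G`. -/
def curvedStrip (b κ : ℝ) (G : Set ℝ) : Set (ℝ × ℝ) :=
  {x | x.1 ∈ Icc (1 : ℝ) 2 ∧ (κ * x.1 ^ b)⁻¹ * x.2 ∈ G}

lemma measurableSet_curvedStrip (b κ : ℝ) {G : Set ℝ} (hG : MeasurableSet G) :
    MeasurableSet (curvedStrip b κ G) := by
  have h : Measurable fun x : ℝ × ℝ => (κ * x.1 ^ b)⁻¹ * x.2 := by fun_prop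
  exact (measurable_fst measurableSet_Icc).inter (h hG)

lemma le_volume_curvedStrip {b κ : ℝ} (hb : 0 ≤ b) (hκ : κ ≠ 0) {G : Set ℝ}
    (hG : MeasurableSet G) :
    ENNReal.ofReal |κ| * volume G ≤ volume (curvedStrip b κ G) := by
  rw [Measure.volume_eq_prod, Measure.prod_apply (measurableSet_curvedStrip b κ hG)]
  calc ENNReal.ofReal |κ| * volume G
      = ∫⁻ _ in Icc (1 : ℝ) 2, ENNReal.ofReal |κ| * volume G := by
        rw [setLIntegral_const, Real.volume_Icc]
        norm_num
    _ ≤ ∫⁻ t in Icc (1 : ℝ) 2, volume (Prod.mk t ⁻¹' curvedStrip b κ G) := by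
        refine setLIntegral_mono' measurableSet_Icc fun t ht => ?_
        have hpos : 1 ≤ t ^ b := Real.one_le_rpow ht.1 hb
        have hne : κ * t ^ b ≠ 0 := mul_ne_zero hκ (by positivity)
        have : Prod.mk t ⁻¹' curvedStrip b κ G = (fun s => (κ * t ^ b)⁻¹ * s) ⁻¹' G := by
          ext s
          simp only [curvedStrip, mem_preimage, mem_ofPred_eq, and_iff_right ht]
        rw [this, Real.volume_preimage_mul_left (inv_ne_zero hne), inv_inv]
        refine mul_le_mul_left (ENNReal.ofReal_le_ofReal ?_) _
        rw [abs_mul, abs_of_nonneg (by linarith : 0 ≤ t ^ b)]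
        exact le_mul_of_one_le_right (abs_nonneg _) hpos
    _ ≤ _ := setLIntegral_le_lintegral _ _

lemma exists_schwartz_bump (α β : ℝ) (hα : 0 < α) (hβ : 0 < β) :
    ∃ f : SchwartzMap (ℝ × ℝ) ℝ, (∀ x, 0 ≤ f x) ∧ (∀ x, f x ≤ 1) ∧
      (∀ x : ℝ × ℝ, |x.1| ≤ α → |x.2| ≤ β → f x = 1) ∧
      ∀ x, f x ≠ 0 → x ∈ Icc (-(2 * α)) (2 * α) ×ˢ Icc (-(2 * β)) (2 * β) := by
  let φ : ContDiffBump (0 : ℝ × ℝ) := ⟨1, 2, one_pos, one_lt_two⟩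
  let g : ℝ × ℝ → ℝ := fun x => φ (α⁻¹ * x.1, β⁻¹ * x.2)
  have hsupp : ∀ x, g x ≠ 0 → x ∈ Icc (-(2 * α)) (2 * α) ×ˢ Icc (-(2 * β)) (2 * β) := by
    intro x hx
    have h : dist (α⁻¹ * x.1, β⁻¹ * x.2) (0 : ℝ × ℝ) < 2 := by
      by_contra! h
      exact hx (φ.zero_of_le_dist h)
    rw [dist_zero_right, Prod.norm_mk, max_lt_iff, Real.norm_eq_abs, Real.norm_eq_abs, abs_mul,
      abs_mul, abs_of_pos (inv_pos.2 hα), abs_of_pos (inv_pos.2 hβ), inv_mul_lt_iff₀ hα,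
      inv_mul_lt_iff₀ hβ] at h
    exact ⟨abs_le.1 (by linarith), abs_le.1 (by linarith)⟩
  have hcs : HasCompactSupport g :=
    HasCompactSupport.of_support_subset_isCompact (isCompact_Icc.prod isCompact_Icc) hsupp
  have hcd : ContDiff ℝ (⊤ : ℕ∞) g := φ.contDiff.comp (by fun_prop)
  refine ⟨hcs.toSchwartzMap hcd, fun x => φ.nonneg, fun x => φ.le_one, fun x h1 h2 => ?_, hsupp⟩
  refine φ.one_of_mem_closedBall ?_
  rw [mem_closedBall_zero_iff, Prod.norm_mk, max_le_iff, Real.norm_eq_abs, Real.norm_eq_abs,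
    abs_mul, abs_mul, abs_of_pos (inv_pos.2 hα), abs_of_pos (inv_pos.2 hβ), inv_mul_le_iff₀ hα,
    inv_mul_le_iff₀ hβ]
  exact ⟨by simpa [φ] using h1, by simpa [φ] using h2⟩

lemma abs_rpow_sub_rpow_le {b : ℝ} (hb : 1 ≤ b) {s t : ℝ} (hs : s ∈ Icc (1 : ℝ) 3)
    (ht : t ∈ Icc (1 : ℝ) 3) : |s ^ b - t ^ b| ≤ b * 3 ^ (b - 1) * |s - t| := by
  refine (convex_Icc (1 : ℝ) 3).norm_image_sub_le_of_norm_hasDerivWithin_le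
    (f := fun x => x ^ b) (f' := fun x => b * x ^ (b - 1)) (fun x hx => ?_) (fun x hx => ?_) ht hs
  · exact (Real.hasDerivAt_rpow_const (Or.inr hb)).hasDerivWithinAt
  · have hx0 : 0 ≤ x := by linarith [hx.1]
    rw [Real.norm_eq_abs, abs_of_nonneg (by positivity)]
    have := Real.rpow_le_rpow hx0 hx.2 (by linarith : 0 ≤ b - 1)
    gcongr

lemma intervalIntegrable_along_curve {b : ℝ} (hb : 0 ≤ b) (cp cm u : ℝ)
    (f : SchwartzMap (ℝ × ℝ) ℝ) (x : ℝ × ℝ) {R : ℝ} (hR : 0 ≤ R) :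
    IntervalIntegrable (fun t => |f (x - (t, u * curve b cp cm t))|) volume 0 R := by
  have hc : Continuous fun t : ℝ => |f (x - (t, u * (cp * t ^ b)))| := by
    have : Continuous fun t : ℝ => t ^ b := Real.continuous_rpow_const hb
    exact (f.continuous.comp (by fun_prop)).abs
  refine (hc.intervalIntegrable 0 R).congr fun t ht => ?_
  rw [uIoc_of_le hR] at ht
  simp only [curve, if_pos ht.1]

/-- A pointwise lower bound for `calM` from the average over `[0,3]` along one curve. -/
lemma le_calM {b : ℝ} (hb : 0 ≤ b) (cp cm : ℝ) {U : Set ℝ} {u : ℝ} (hu : u ∈ U)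
    (f : SchwartzMap (ℝ × ℝ) ℝ) (hf1 : ∀ x, |f x| ≤ 1) (x : ℝ × ℝ) {s δ : ℝ} (hs : 0 ≤ s)
    (hδ : 0 ≤ δ) (hsδ : s + δ ≤ 3)
    (hf : ∀ t ∈ Ioc s (s + δ), f (x - (t, u * (cp * t ^ b))) = 1) :
    δ / 3 ≤ calM b cp cm U f x := by
  have havg : ∀ (v : ℝ) (R : {R : ℝ // 0 < R}),
      (R : ℝ)⁻¹ * ∫ t in (0 : ℝ)..R, |f (x - (t, v * curve b cp cm t))| ≤ 1 := by
    rintro v ⟨R, hR⟩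
    have h := intervalIntegral.norm_integral_le_of_norm_le_const (a := 0) (b := R) (C := 1)
      (f := fun t => |f (x - (t, v * curve b cp cm t))|) (fun t _ => by simpa using hf1 _)
    rw [sub_zero, one_mul, abs_of_pos hR] at h
    rw [inv_mul_le_iff₀ hR, mul_one]
    exact (le_abs_self _).trans h
  have hMu : ∀ v, Mu b cp cm v f x ≤ 1 := fun v => Real.iSup_le (havg v) zero_le_one
  have h1 : Mu b cp cm u f x ≤ calM b cp cm U f x :=
    le_ciSup (f := fun v : U => Mu b cp cm v f x) ⟨1, by rintro _ ⟨v, rfl⟩; exact hMu v⟩ ⟨u, hu⟩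
  refine le_trans ?_ h1
  have h2 := le_ciSup (f := fun R : {R : ℝ // 0 < R} =>
    (R : ℝ)⁻¹ * ∫ t in (0 : ℝ)..R, |f (x - (t, u * curve b cp cm t))|)
    ⟨1, by rintro _ ⟨R, rfl⟩; exact havg u R⟩ ⟨3, by norm_num⟩
  refine le_trans ?_ h2
  have hi := intervalIntegrable_along_curve hb cp cm u f x (by norm_num : (0 : ℝ) ≤ 3)
  have h3 : ∫ t in s..(s + δ), |f (x - (t, u * curve b cp cm t))| ≤
      ∫ t in (0 : ℝ)..3, |f (x - (t, u * curve b cp cm t))| :=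
    intervalIntegral.integral_mono_interval hs (by linarith) hsδ
      (Eventually.of_forall fun t => abs_nonneg _) hi
  have h4 : ∫ t in s..(s + δ), |f (x - (t, u * curve b cp cm t))| = ∫ _ in s..(s + δ), (1 : ℝ) := by
    refine intervalIntegral.integral_congr_ae (Eventually.of_forall fun t ht => ?_)
    rw [uIoc_of_le (by linarith)] at ht
    simp only [curve, if_pos (hs.trans_lt ht.1), hf t ht, abs_one]
  rw [h4, intervalIntegral.integral_const, add_sub_cancel_left, smul_eq_mul, mul_one] at h3
  dsimp only
  linarith

/-- If `calM` is bounded on `L^p` then the covering numbers of `U^r` are `O(δ ^ (1 - p))`. -/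
lemma covN_mul_le_of_bounded {b cp cm : ℝ} (hb : 1 < b) (hcp : cp ≠ 0) {U : Set ℝ} {p C : ℝ}
    (hp : 1 < p)
    (hC : ∀ f : SchwartzMap (ℝ × ℝ) ℝ, eLpNorm (calM b cp cm U ⇑f) (eN p) volume
      ≤ ENNReal.ofReal C * eLpNorm ⇑f (eN p) volume) {r δ : ℝ} (hr : 0 < r) (hδ : 0 < δ)
    (hδ1 : δ ≤ 1) :
    (covN (UrSet U r) δ : ℝ) * δ ^ (p - 1) ≤
      (max C 0) ^ p * (16 * (2 ^ b + 2 * (b * 3 ^ (b - 1)))) * 3 ^ p := by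
  set L : ℝ := 2 ^ b + 2 * (b * 3 ^ (b - 1)) with hL
  have hb0 : 0 < b := by linarith
  have hL0 : 0 < L := by positivity
  set κ : ℝ := r * cp with hκ
  have hκ0 : κ ≠ 0 := mul_ne_zero hr.ne' hcp
  have hκ1 : 0 < |κ| := abs_pos.2 hκ0
  obtain ⟨K, hK, hKρ⟩ := exists_grid_cells (UrSet U r) (fun ρ hρ => hρ.1) δ hδ
  obtain ⟨f, hf0, hf1, hfone, hfsupp⟩ := exists_schwartz_bump δ (|κ| * (L * δ)) hδ (by positivity)
  set E := curvedStrip b κ (gridUnion K δ) with hE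
  set B : Set (ℝ × ℝ) := Icc (-(2 * δ)) (2 * δ) ×ˢ
    Icc (-(2 * (|κ| * (L * δ)))) (2 * (|κ| * (L * δ))) with hB
  have hEm : MeasurableSet E := measurableSet_curvedStrip b κ (measurableSet_gridUnion K δ)
  have hBm : MeasurableSet B := measurableSet_Icc.prod measurableSet_Icc
  have hlow : ∀ x ∈ E, δ / 3 ≤ calM b cp cm U f x := by
    rintro ⟨x₁, x₂⟩ ⟨hx₁, hx₂⟩
    dsimp only at hx₁ hx₂
    set σ := (κ * x₁ ^ b)⁻¹ * x₂ with hσ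
    obtain ⟨k, hk, hσk⟩ := mem_iUnion₂.1 hx₂
    obtain ⟨ρ, ⟨hρ12, hρU⟩, hρ1, hρ2⟩ := hKρ k hk
    have hσρ : |σ - ρ| ≤ δ := abs_le.2 ⟨by linarith [hσk.1], by linarith [hσk.2]⟩
    have hx0 : (0 : ℝ) < x₁ := by linarith [hx₁.1]
    have hxb : 0 < x₁ ^ b := by positivity
    have hx₂' : x₂ = κ * x₁ ^ b * σ := by rw [hσ, mul_inv_cancel_left₀ (by positivity)]
    refine le_calM hb0.le cp cm hρU f (fun x => abs_le.2 ⟨by linarith [hf0 x], hf1 x⟩) _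
      hx0.le hδ.le (by linarith [hx₁.2]) fun t ht => ?_
    have hxt : |x₁ - t| ≤ δ := abs_le.2 ⟨by linarith [ht.2], by linarith [ht.1]⟩
    refine hfone _ hxt ?_
    have hsplit : x₂ - r * ρ * (cp * t ^ b) =
        κ * (x₁ ^ b * (σ - ρ) + ρ * (x₁ ^ b - t ^ b)) := by
      rw [hx₂', hκ]; ring
    simp only [Prod.snd_sub]
    rw [hsplit, abs_mul]
    gcongr
    have e1 : |x₁ ^ b * (σ - ρ)| ≤ 2 ^ b * δ := by
      rw [abs_mul, abs_of_pos hxb]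
      have := Real.rpow_le_rpow hx0.le hx₁.2 hb0.le
      gcongr
    have e2 : |ρ * (x₁ ^ b - t ^ b)| ≤ 2 * (b * 3 ^ (b - 1) * δ) := by
      rw [abs_mul, abs_of_pos (by linarith [hρ12.1])]
      have h := abs_rpow_sub_rpow_le hb.le (s := x₁) (t := t) ⟨hx₁.1, by linarith [hx₁.2]⟩
        ⟨by linarith [ht.1, hx₁.1], by linarith [ht.2, hx₁.2]⟩
      have h' : b * 3 ^ (b - 1) * |x₁ - t| ≤ b * 3 ^ (b - 1) * δ := by gcongr
      exact mul_le_mul hρ12.2 (h.trans h') (abs_nonneg _) zero_le_two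
    refine (abs_add_le _ _).trans ((add_le_add e1 e2).trans_eq ?_)
    rw [hL]; ring
  have hp0 : 0 < p := by linarith
  have hpe0 : eN p ≠ 0 := by simpa [eN] using hp0
  have hpet : eN p ≠ ⊤ := ENNReal.ofReal_ne_top
  have hpr : (eN p).toReal = p := ENNReal.toReal_ofReal hp0.le
  have hvE : ENNReal.ofReal (|κ| * (K.card * δ)) ≤ volume E := by
    have := le_volume_curvedStrip hb0.le hκ0 (measurableSet_gridUnion K δ)
    rwa [volume_gridUnion K δ hδ, ← ENNReal.ofReal_mul hκ1.le] at this
  have hvB : volume B = ENNReal.ofReal (|κ| * (16 * L) * (δ * δ)) := by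
    rw [hB, Measure.volume_eq_prod, Measure.prod_prod, Real.volume_Icc, Real.volume_Icc,
      ← ENNReal.ofReal_mul (by linarith)]
    congr 1; ring
  have hM : ENNReal.ofReal (δ / 3) * volume E ^ (1 / p) ≤
      eLpNorm (calM b cp cm U f) (eN p) volume := by
    have h := eLpNorm_indicator_const (μ := volume) (c := δ / 3) hEm hpe0 hpet
    rw [hpr, Real.enorm_of_nonneg (by positivity)] at h
    rw [← h]
    refine eLpNorm_mono fun x => ?_
    by_cases hx : x ∈ E
    · rw [indicator_of_mem hx, Real.norm_of_nonneg (by positivity)]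
      exact (hlow x hx).trans (le_abs_self _)
    · simp [indicator_of_notMem hx]
  have hF : eLpNorm f (eN p) volume ≤ volume B ^ (1 / p) := by
    have h := eLpNorm_indicator_const (μ := volume) (c := (1 : ℝ)) hBm hpe0 hpet
    rw [hpr, enorm_one, one_mul] at h
    rw [← h]
    refine eLpNorm_mono fun x => ?_
    by_cases hx : x ∈ B
    · rw [indicator_of_mem hx, norm_one, Real.norm_of_nonneg (hf0 x)]
      exact hf1 x
    · rw [indicator_of_notMem hx, not_not.1 fun h => hx (hfsupp x h)]
  have hmain : ENNReal.ofReal (δ / 3) * volume E ^ (1 / p) ≤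
      ENNReal.ofReal (max C 0) * volume B ^ (1 / p) := by
    refine hM.trans ((hC f).trans ?_)
    gcongr
    exact le_max_left _ _
  have hpow := ENNReal.rpow_le_rpow hmain hp0.le
  rw [ENNReal.mul_rpow_of_nonneg _ _ hp0.le, ENNReal.mul_rpow_of_nonneg _ _ hp0.le,
    ← ENNReal.rpow_mul, ← ENNReal.rpow_mul, one_div_mul_cancel hp0.ne', ENNReal.rpow_one,
    ENNReal.rpow_one, ENNReal.ofReal_rpow_of_nonneg (by positivity) hp0.le,
    ENNReal.ofReal_rpow_of_nonneg (le_max_right _ _) hp0.le, hvB,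
    ← ENNReal.ofReal_mul (by positivity)] at hpow
  have hreal := (mul_le_mul_right hvE (ENNReal.ofReal ((δ / 3) ^ p))).trans hpow
  rw [← ENNReal.ofReal_mul (by positivity), ENNReal.ofReal_le_ofReal_iff (by positivity),
    Real.div_rpow hδ.le (by norm_num)] at hreal
  have hδp : δ ^ p = δ ^ (p - 1) * δ := by
    rw [← Real.rpow_add_one hδ.ne', sub_add_cancel]
  have h3p : (0 : ℝ) < 3 ^ p := by positivity
  rw [hδp, div_mul_eq_mul_div, div_le_iff₀ h3p] at hreal
  have hfin : (K.card : ℝ) * δ ^ (p - 1) ≤ (max C 0) ^ p * (16 * L) * 3 ^ p := by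
    refine le_of_mul_le_mul_right (a := |κ| * (δ * δ)) ?_ (by positivity)
    calc _ = δ ^ (p - 1) * δ * (|κ| * (K.card * δ)) := by ring
      _ ≤ _ := hreal
      _ = _ := by ring
  refine le_trans ?_ hfin
  gcongr

/-- Arbitrarily small scales `δ` at which `U^r` needs more than `δ ^ (-q)` intervals. -/
lemma exists_lt_covN {U : Set ℝ} {q : ℝ} (hq : 0 ≤ q) (hqU : q < pcr U - 1) {ε : ℝ} (hε : 0 < ε) :
    ∃ δ r : ℝ, 0 < δ ∧ δ < ε ∧ δ < 1 ∧ 0 < r ∧ δ ^ (-q) < covN (UrSet U r) δ := by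
  rw [pcr, add_sub_cancel_left] at hqU
  have hsmall : ∀ᶠ δ : ℝ in 𝓝[>] 0, 0 < δ ∧ δ < ε ∧ δ < 1 := by
    filter_upwards [Ioo_mem_nhdsGT (lt_min hε one_pos)] with δ hδ
    exact ⟨hδ.1, lt_min_iff.1 hδ.2⟩
  have hfreq := frequently_lt_of_lt_limsup
    (IsCoboundedUnder.of_frequently_ge (a := 0) (Eventually.frequently ?_)) hqU
  · obtain ⟨δ, hδ, hδ0, hδε, hδ1⟩ := (hfreq.and_eventually hsmall).exists
    have hlog : 0 < Real.log δ⁻¹ := Real.log_pos ((one_lt_inv₀ hδ0).2 hδ1)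
    rw [lt_div_iff₀ hlog] at hδ
    have : Nonempty {r : ℝ // 0 < r} := ⟨⟨1, one_pos⟩⟩
    obtain ⟨⟨r, hr⟩, hlt⟩ := exists_lt_of_lt_ciSup hδ
    refine ⟨δ, r, hδ0, hδε, hδ1, hr, ?_⟩
    have hpos : 0 < (covN (UrSet U r) δ : ℝ) := by
      rcases Nat.eq_zero_or_pos (covN (UrSet U r) δ) with h | h
      · have : 0 ≤ q * Real.log δ⁻¹ := by positivity
        simp only [h, Nat.cast_zero, Real.log_zero] at hlt
        linarith
      · exact_mod_cast h
    rw [Real.rpow_def_of_pos hδ0, ← Real.lt_log_iff_exp_lt hpos]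
    rw [Real.log_inv] at hlt
    linarith
  · filter_upwards [hsmall] with δ hδ
    refine div_nonneg (Real.iSup_nonneg fun r => Real.log_natCast_nonneg _) ?_
    exact Real.log_nonneg ((one_le_inv₀ hδ.1).2 hδ.2.2.le)

theorem statement1 (b cp cm : ℝ) (hb : 1 < b) (hcp : cp ≠ 0) (hcm : cm ≠ 0)
    (U : Set ℝ) (hUne : U.Nonempty) (hUsub : U ⊆ Ioi (0:ℝ)) (p : ℝ) (hp1 : 1 < p) (hp2 : p ≤ 2) (hpcr : p < pcr U) :
    ¬ ∃ C : ℝ, ∀ f : SchwartzMap (ℝ × ℝ) ℝ,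
      eLpNorm (calM b cp cm U ⇑f) (eN p) volume
        ≤ ENNReal.ofReal C * eLpNorm ⇑f (eN p) volume := by
  rintro ⟨C, hC⟩
  obtain ⟨q, hpq, hq⟩ := exists_between (show p - 1 < pcr U - 1 by linarith)
  set D : ℝ := (max C 0) ^ p * (16 * (2 ^ b + 2 * (b * 3 ^ (b - 1)))) * 3 ^ p
  have hlim : Tendsto (fun δ : ℝ => δ ^ (p - 1 - q)) (𝓝[>] 0) atTop :=
    tendsto_rpow_neg_nhdsGT_zero (by linarith)
  obtain ⟨ε, hε, hεD⟩ := mem_nhdsGT_iff_exists_Ioo_subset.1 (hlim.eventually_gt_atTop D)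
  obtain ⟨δ, r, hδ, hδε, hδ1, hr, hcov⟩ := exists_lt_covN (by linarith) hq hε
  have hle := covN_mul_le_of_bounded hb hcp hp1 hC hr hδ hδ1.le
  have hgt : D < δ ^ (p - 1 - q) := hεD ⟨hδ, hδε⟩
  have hsplit : δ ^ (p - 1 - q) = δ ^ (-q) * δ ^ (p - 1) := by
    rw [← Real.rpow_add hδ]
    congr 1
    ring
  have : δ ^ (-q) * δ ^ (p - 1) ≤ covN (UrSet U r) δ * δ ^ (p - 1) := by gcongr
  linarith

end
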